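/- Let n be even, let k be even with 0 ≤ k ≤ n, let θ₁, …, θ_{k/2} and θ̂₁, …, θ̂_{(n−k)/2} be real numbers, and consider the endomorphism of ΛV given by A = ĉ(e₁)∘⋯∘ĉ(e_k) ∘ ∏_{j=1}^{k/2} [ cos(θ_j/2)·Id − sin(θ_j/2)·ĉ(e_{2j−1})∘ĉ(e_{2j}) ] ∘ ∏_{l=1}^{(n−k)/2} [ cos(θ̂_l/2)·Id − sin(θ̂_l/2)·ĉ(e_{k+2l−1})∘ĉ(e_{k+2l}) ]. Then the coefficient of the volume element e₁ ∧ ⋯ ∧ e_n in A(1) (equivalently, the top-degree Berezin component of the symbol of A) equals (−1)^{(n−k)/2} · ∏_{j=1}^{k/2} cos(θ_j/2) · ∏_{l=1}^{(n−k)/2} sin(θ̂_l/2). -/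

import Mathlib

open scoped RealInnerProductSpace

/-- Exterior multiplication `e ∧ ·` as an endomorphism of the exterior algebra `ΛV`
of `V = ℝⁿ`. -/
noncomputable def wedgeMul (n : ℕ) (e : EuclideanSpace ℝ (Fin n)) :
    Module.End ℝ (ExteriorAlgebra ℝ (EuclideanSpace ℝ (Fin n))) :=
  LinearMap.mulLeft ℝ (ExteriorAlgebra.ι ℝ e)

/-- Interior multiplication (contraction) `i_e` with respect to the standard inner
product, as an endomorphism of the exterior algebra `ΛV` of `V = ℝⁿ`. -/
noncomputable def intMul (n : ℕ) (e : EuclideanSpace ℝ (Fin n)) :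
    Module.End ℝ (ExteriorAlgebra ℝ (EuclideanSpace ℝ (Fin n))) :=
  CliffordAlgebra.contractLeft (Q := (0 : QuadraticForm ℝ (EuclideanSpace ℝ (Fin n))))
    (innerₗ (EuclideanSpace ℝ (Fin n)) e)

/-- The Clifford action `c(e) = e∧ − i_e`. -/
noncomputable def cOp (n : ℕ) (e : EuclideanSpace ℝ (Fin n)) :
    Module.End ℝ (ExteriorAlgebra ℝ (EuclideanSpace ℝ (Fin n))) :=
  wedgeMul n e - intMul n e

/-- The Clifford action `ĉ(e) = e∧ + i_e`. -/
noncomputable def chatOp (n : ℕ) (e : EuclideanSpace ℝ (Fin n)) :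
    Module.End ℝ (ExteriorAlgebra ℝ (EuclideanSpace ℝ (Fin n))) :=
  wedgeMul n e + intMul n e

/-- The standard orthonormal basis vector `e_i` of `ℝⁿ`. -/
noncomputable def stdVec (n : ℕ) (i : Fin n) : EuclideanSpace ℝ (Fin n) :=
  EuclideanSpace.single i (1 : ℝ)

section CliffordFamily

variable {ι M : Type*} [AddCommGroup M] [Module ℝ M] {a c : ι → Module.End ℝ M}

/-- Operators `a i` and `c i` satisfying the relations of the contractions and of the Clifford
operators attached to an orthonormal family. -/
structure IsCliffordFamily (a c : ι → Module.End ℝ M) : Prop where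
  ann_mul_self : ∀ i, a i * c i = 1 - c i * a i
  ann_mul : ∀ i j, i ≠ j → a i * c j = -(c j * a i)
  mul_self : ∀ i, c i * c i = 1
  anticomm : ∀ i j, i ≠ j → c i * c j = -(c j * c i)

namespace IsCliffordFamily

theorem commute_ann_pair (h : IsCliffordFamily a c) {i j k : ι} (hj : i ≠ j) (hk : i ≠ k) :
    Commute (a i) (c j * c k) := by
  change a i * (c j * c k) = c j * c k * a i
  rw [← mul_assoc, h.ann_mul i j hj, neg_mul, mul_assoc, h.ann_mul i k hk, mul_neg, neg_neg,
    mul_assoc]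

theorem commute_pair (h : IsCliffordFamily a c) {i j k : ι} (hj : i ≠ j) (hk : i ≠ k) :
    Commute (c i) (c j * c k) := by
  change c i * (c j * c k) = c j * c k * c i
  rw [← mul_assoc, h.anticomm i j hj, neg_mul, mul_assoc, h.anticomm i k hk, mul_neg, neg_neg,
    mul_assoc]

theorem pair_mul_self (h : IsCliffordFamily a c) {i j : ι} (hij : i ≠ j) :
    c i * c j * (c i * c j) = -1 := by
  rw [mul_assoc, (h.anticomm i j hij), mul_neg, ← mul_assoc (c j), h.mul_self, one_mul, mul_neg,
    h.mul_self]

theorem pair_mul_rotation (h : IsCliffordFamily a c) {i j : ι} (hij : i ≠ j) (x y : ℝ) :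
    c i * c j * (x • 1 - y • (c i * c j)) = y • 1 + x • (c i * c j) := by
  rw [mul_sub, mul_smul_comm, mul_smul_comm, h.pair_mul_self hij, mul_one, smul_neg,
    sub_neg_eq_add, add_comm]

theorem ann_ann_apply (h : IsCliffordFamily a c) {i j : ι} (hij : i ≠ j) (x y : ℝ) {v : M}
    (hi : a i v = 0) (hj : a j v = 0) :
    a j (a i ((x • 1 + y • (c i * c j) : Module.End ℝ M) v)) = y • v := by
  have h1 : ∀ w, a i (c i w) = w - c i (a i w) := fun w ↦
    LinearMap.congr_fun (h.ann_mul_self i) w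
  have h2 : ∀ w, a j (c j w) = w - c j (a j w) := fun w ↦
    LinearMap.congr_fun (h.ann_mul_self j) w
  have h3 : ∀ w, a i (c j w) = -c j (a i w) := fun w ↦
    LinearMap.congr_fun (h.ann_mul i j hij) w
  simp [h1, h2, h3, hi, hj]

/-- The operators indexed by `i` commute with products of rotation factors avoiding `i`. -/
theorem commute_prod (h : IsCliffordFamily a c) {m : ℕ} (f g : Fin m → ι) (x y : Fin m → ℝ)
    {i : ι} (hf : ∀ j, i ≠ f j) (hg : ∀ j, i ≠ g j) :
    Commute (a i) (List.ofFn fun j ↦ x j • 1 + y j • (c (f j) * c (g j))).prod := by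
  refine Commute.list_prod_right _ _ fun b hb ↦ ?_
  obtain ⟨j, rfl⟩ := List.mem_ofFn.1 hb
  exact ((Commute.one_right _).smul_right _).add_right
    ((h.commute_ann_pair (hf j) (hg j)).smul_right _)

theorem ann_prod_apply (h : IsCliffordFamily a c) {m : ℕ} (f g : Fin m → ι) (x y : Fin m → ℝ)
    {i : ι} (hf : ∀ j, i ≠ f j) (hg : ∀ j, i ≠ g j) {v : M} (hv : a i v = 0) :
    a i ((List.ofFn fun j ↦ x j • 1 + y j • (c (f j) * c (g j))).prod v) = 0 := by
  have := LinearMap.congr_fun (h.commute_prod f g x y hf hg).eq v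
  simpa [hv] using this

/-- The product of an even number of Clifford operators, followed by rotations in the same
planes, is again a product of factors `x + y P`, where `P` ranges over the products
of two consecutive operators. -/
theorem prod_mul_prod_rotation (h : IsCliffordFamily a c) : ∀ {m : ℕ} (f : Fin (2 * m) → ι)
    (_ : f.Injective) (x y : Fin m → ℝ),
    (List.ofFn fun i ↦ c (f i)).prod *
      (List.ofFn fun j : Fin m ↦ x j • (1 : Module.End ℝ M) -
        y j • (c (f ⟨2 * j, by omega⟩) * c (f ⟨2 * j + 1, by omega⟩))).prod =
      (List.ofFn fun j : Fin m ↦ y j • (1 : Module.End ℝ M) +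
        x j • (c (f ⟨2 * j, by omega⟩) * c (f ⟨2 * j + 1, by omega⟩))).prod
  | 0, _, _, _, _ => by simp
  | m + 1, f, hf, x, y => by
    have ih := prod_mul_prod_rotation h (fun i : Fin (2 * m) ↦ f i.succ.succ)
      (fun i j hij ↦ by simpa using hf hij) (fun j ↦ x j.succ) (fun j ↦ y j.succ)
    have h0 : ∀ i : Fin (2 * m), f i.succ.succ ≠ f 0 := fun i e ↦ by
      simpa using hf e
    have h1 : ∀ i : Fin (2 * m), f i.succ.succ ≠ f 1 := fun i e ↦
      Fin.succ_ne_zero i (Fin.succ_injective _ (hf e))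
    have h01 : f 0 ≠ f 1 := fun e ↦ by simpa [Fin.ext_iff] using hf e
    have hcomm : Commute (List.ofFn fun i : Fin (2 * m) ↦ c (f i.succ.succ)).prod
        (x 0 • 1 - y 0 • (c (f 0) * c (f 1))) := by
      refine Commute.list_prod_left _ _ fun b hb ↦ ?_
      obtain ⟨i, rfl⟩ := List.mem_ofFn.1 hb
      exact ((Commute.one_right _).smul_right _).sub_right
        ((h.commute_pair (h0 i) (h1 i)).smul_right _)
    have hsplit : (List.ofFn fun i : Fin (2 * (m + 1)) ↦ c (f i)).prod =
        c (f 0) * c (f 1) * (List.ofFn fun i : Fin (2 * m) ↦ c (f i.succ.succ)).prod := by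
      change (List.ofFn fun i : Fin (2 * m + 1 + 1) ↦ c (f i)).prod = _
      rw [List.ofFn_succ, List.ofFn_succ, List.prod_cons, List.prod_cons, ← mul_assoc]
      rfl
    rw [hsplit, List.ofFn_succ, List.ofFn_succ, List.prod_cons, List.prod_cons]
    change _ * ((x 0 • 1 - y 0 • (c (f 0) * c (f 1))) * _) =
      (y 0 • 1 + x 0 • (c (f 0) * c (f 1))) * _
    rw [mul_assoc, ← mul_assoc _ (_ - _), hcomm.eq, mul_assoc (_ - _),
      ← mul_assoc (c (f 0) * c (f 1)), h.pair_mul_rotation h01]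
    exact congrArg _ ih

/-- Contracting with all the vectors of the planes of `∏ (x + y P)` extracts `∏ y`. -/
theorem prod_ann_apply (h : IsCliffordFamily a c) : ∀ {m : ℕ} (f : Fin (2 * m) → ι)
    (_ : f.Injective) (x y : Fin m → ℝ) (v : M) (_ : ∀ i, a (f i) v = 0),
    (List.ofFn fun i ↦ a (f i)).reverse.prod
      ((List.ofFn fun j : Fin m ↦ x j • (1 : Module.End ℝ M) +
        y j • (c (f ⟨2 * j, by omega⟩) * c (f ⟨2 * j + 1, by omega⟩))).prod v) =
      (∏ j, y j) • v
  | 0, _, _, _, _, _, _ => by simp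
  | m + 1, f, hf, x, y, v, hv => by
    have ih := prod_ann_apply h (fun i : Fin (2 * m) ↦ f i.succ.succ)
      (fun i j hij ↦ by simpa using hf hij) (fun j ↦ x j.succ) (fun j ↦ y j.succ) v
      (fun i ↦ hv _)
    have h0 : ∀ i : Fin (2 * m), f 0 ≠ f i.succ.succ := fun i e ↦ by
      simpa [Fin.ext_iff] using hf e
    have h1 : ∀ i : Fin (2 * m), f 1 ≠ f i.succ.succ := fun i e ↦
      Fin.succ_ne_zero i (Fin.succ_injective _ (hf e.symm))
    have h01 : f 0 ≠ f 1 := fun e ↦ by simpa [Fin.ext_iff] using hf e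
    have hsplit : (List.ofFn fun i : Fin (2 * (m + 1)) ↦ a (f i)).reverse.prod =
        (List.ofFn fun i : Fin (2 * m) ↦ a (f i.succ.succ)).reverse.prod *
          (a (f 1) * a (f 0)) := by
      change (List.ofFn fun i : Fin (2 * m + 1 + 1) ↦ a (f i)).reverse.prod = _
      rw [List.ofFn_succ, List.ofFn_succ, List.reverse_cons, List.reverse_cons, List.prod_append,
        List.prod_append, List.prod_singleton, List.prod_singleton, mul_assoc]
      rfl
    rw [hsplit, List.ofFn_succ, List.prod_cons, Fin.prod_univ_succ, Module.End.mul_apply,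
      Module.End.mul_apply, Module.End.mul_apply]
    refine (congrArg _ (h.ann_ann_apply h01 (x 0) (y 0)
      (h.ann_prod_apply _ _ _ _ (fun j ↦ h0 ⟨2 * j, by omega⟩)
        (fun j ↦ h0 ⟨2 * j + 1, by omega⟩) (hv 0))
      (h.ann_prod_apply _ _ _ _ (fun j ↦ h1 ⟨2 * j, by omega⟩)
        (fun j ↦ h1 ⟨2 * j + 1, by omega⟩) (hv 1)))).trans ?_
    rw [map_smul, mul_smul]
    exact congrArg _ ih

end IsCliffordFamily

end CliffordFamily

theorem intMul_wedgeMul (n : ℕ) (e f : EuclideanSpace ℝ (Fin n))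
    (x : ExteriorAlgebra ℝ (EuclideanSpace ℝ (Fin n))) :
    intMul n e (wedgeMul n f x) = ⟪e, f⟫ • x - wedgeMul n f (intMul n e x) :=
  CliffordAlgebra.contractLeft_ι_mul _ _ _

theorem intMul_intMul_comm (n : ℕ) (e f : EuclideanSpace ℝ (Fin n))
    (x : ExteriorAlgebra ℝ (EuclideanSpace ℝ (Fin n))) :
    intMul n e (intMul n f x) = -intMul n f (intMul n e x) :=
  CliffordAlgebra.contractLeft_comm _ _ _

theorem intMul_intMul_self (n : ℕ) (e : EuclideanSpace ℝ (Fin n))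
    (x : ExteriorAlgebra ℝ (EuclideanSpace ℝ (Fin n))) : intMul n e (intMul n e x) = 0 :=
  CliffordAlgebra.contractLeft_contractLeft _ _

theorem wedgeMul_wedgeMul_comm (n : ℕ) (e f : EuclideanSpace ℝ (Fin n))
    (x : ExteriorAlgebra ℝ (EuclideanSpace ℝ (Fin n))) :
    wedgeMul n e (wedgeMul n f x) = -wedgeMul n f (wedgeMul n e x) := by
  have := ExteriorAlgebra.ι_add_mul_swap (R := ℝ) e f
  simp only [wedgeMul, LinearMap.mulLeft_apply, ← mul_assoc, eq_neg_of_add_eq_zero_left this,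
    neg_mul]

theorem wedgeMul_wedgeMul_self (n : ℕ) (e : EuclideanSpace ℝ (Fin n))
    (x : ExteriorAlgebra ℝ (EuclideanSpace ℝ (Fin n))) : wedgeMul n e (wedgeMul n e x) = 0 := by
  simp only [wedgeMul, LinearMap.mulLeft_apply, ← mul_assoc, ExteriorAlgebra.ι_sq_zero, zero_mul]

theorem intMul_one (n : ℕ) (e : EuclideanSpace ℝ (Fin n)) : intMul n e 1 = 0 :=
  CliffordAlgebra.contractLeft_one _ _

theorem inner_stdVec (n : ℕ) (i j : Fin n) :
    ⟪stdVec n i, stdVec n j⟫ = if i = j then (1 : ℝ) else 0 := by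
  simp [stdVec, EuclideanSpace.inner_single_left]

theorem isCliffordFamily_stdVec (n : ℕ) :
    IsCliffordFamily (fun i ↦ intMul n (stdVec n i)) (fun i ↦ chatOp n (stdVec n i)) where
  ann_mul_self i := by
    refine LinearMap.ext fun x ↦ ?_
    simp [chatOp, intMul_wedgeMul, intMul_intMul_self, inner_stdVec,
      -inner_self_eq_norm_sq_to_K]
  ann_mul i j hij := by
    refine LinearMap.ext fun x ↦ ?_
    simp only [chatOp, Module.End.mul_apply, LinearMap.add_apply, map_add, LinearMap.neg_apply,
      intMul_wedgeMul, inner_stdVec, if_neg hij, zero_smul,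
      intMul_intMul_comm n (stdVec n i) (stdVec n j)]
    abel
  mul_self i := by
    refine LinearMap.ext fun x ↦ ?_
    simp [chatOp, intMul_wedgeMul, intMul_intMul_self, wedgeMul_wedgeMul_self, inner_stdVec,
      -inner_self_eq_norm_sq_to_K]
  anticomm i j hij := by
    refine LinearMap.ext fun x ↦ ?_
    simp only [chatOp, Module.End.mul_apply, LinearMap.add_apply, map_add, LinearMap.neg_apply,
      intMul_wedgeMul, inner_stdVec, if_neg hij, if_neg hij.symm, zero_smul,
      intMul_intMul_comm n (stdVec n i) (stdVec n j),
      wedgeMul_wedgeMul_comm n (stdVec n i) (stdVec n j)]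
    abel

/-- with `n = 2p + 2q` even and `k = 2p` even, for the operator
`A = ĉ(e₁)⋯ĉ(e_k) ∘ ∏_{j=1}^{k/2} [cos(θ_j/2) − sin(θ_j/2) ĉ(e_{2j−1})ĉ(e_{2j})]
∘ ∏_{l=1}^{(n−k)/2} [cos(θ̂_l/2) − sin(θ̂_l/2) ĉ(e_{k+2l−1})ĉ(e_{k+2l})]`,
the coefficient of the volume element `e₁ ∧ ⋯ ∧ e_n` in `A(1)` (extracted by full
contraction `i_{e_n}∘⋯∘i_{e_1}`) equals
`(−1)^{(n−k)/2} ∏_j cos(θ_j/2) ∏_l sin(θ̂_l/2)`. -/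
theorem berezin_coeff_chat_product (p q : ℕ) (θ : Fin p → ℝ) (θhat : Fin q → ℝ) :
    ((List.ofFn fun i : Fin (2 * p + 2 * q) =>
        intMul (2 * p + 2 * q) (stdVec (2 * p + 2 * q) i)).reverse.prod)
      (((List.ofFn fun i : Fin (2 * p) =>
          chatOp (2 * p + 2 * q)
            (stdVec (2 * p + 2 * q) ⟨(i : ℕ), by have := i.isLt; omega⟩)).prod *
        (List.ofFn fun j : Fin p =>
          Real.cos (θ j / 2) •
              (1 : Module.End ℝ (ExteriorAlgebra ℝ (EuclideanSpace ℝ (Fin (2 * p + 2 * q)))))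
            - Real.sin (θ j / 2) •
              (chatOp (2 * p + 2 * q)
                  (stdVec (2 * p + 2 * q) ⟨2 * (j : ℕ), by have := j.isLt; omega⟩) *
                chatOp (2 * p + 2 * q)
                  (stdVec (2 * p + 2 * q) ⟨2 * (j : ℕ) + 1, by have := j.isLt; omega⟩))).prod *
        (List.ofFn fun l : Fin q =>
          Real.cos (θhat l / 2) •
              (1 : Module.End ℝ (ExteriorAlgebra ℝ (EuclideanSpace ℝ (Fin (2 * p + 2 * q)))))
            - Real.sin (θhat l / 2) •
              (chatOp (2 * p + 2 * q)
                  (stdVec (2 * p + 2 * q) ⟨2 * p + 2 * (l : ℕ), by have := l.isLt; omega⟩) *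
                chatOp (2 * p + 2 * q)
                  (stdVec (2 * p + 2 * q)
                    ⟨2 * p + 2 * (l : ℕ) + 1, by have := l.isLt; omega⟩))).prod)
        (1 : ExteriorAlgebra ℝ (EuclideanSpace ℝ (Fin (2 * p + 2 * q)))))
      = ((-1 : ℝ) ^ q * (∏ j : Fin p, Real.cos (θ j / 2)) *
          ∏ l : Fin q, Real.sin (θhat l / 2)) •
        (1 : ExteriorAlgebra ℝ (EuclideanSpace ℝ (Fin (2 * p + 2 * q)))) := by
  have h := isCliffordFamily_stdVec (2 * p + 2 * q)
  have hl := h.prod_ann_apply (Fin.castAdd (2 * q) : Fin (2 * p) → Fin (2 * p + 2 * q))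
    (Fin.castAdd_injective _ _) (fun j ↦ Real.sin (θ j / 2)) (fun j ↦ Real.cos (θ j / 2))
  have hr := h.prod_ann_apply (Fin.natAdd (2 * p) : Fin (2 * q) → Fin (2 * p + 2 * q))
    (Fin.natAdd_injective _ _) (fun l ↦ Real.cos (θhat l / 2)) (fun l ↦ -Real.sin (θhat l / 2))
    1 (fun _ ↦ intMul_one _ _)
  have hrot := h.prod_mul_prod_rotation
    (Fin.castAdd (2 * q) : Fin (2 * p) → Fin (2 * p + 2 * q))
    (Fin.castAdd_injective _ _) (fun j ↦ Real.cos (θ j / 2)) (fun j ↦ Real.sin (θ j / 2))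
  have hann := fun i : Fin (2 * p) ↦ h.ann_prod_apply (i := Fin.castAdd (2 * q) i)
    (fun l : Fin q ↦ Fin.natAdd (2 * p) ⟨2 * l, by omega⟩)
    (fun l : Fin q ↦ Fin.natAdd (2 * p) ⟨2 * l + 1, by omega⟩)
    (fun l ↦ Real.cos (θhat l / 2)) (fun l ↦ -Real.sin (θhat l / 2))
    (fun l ↦ by simp [Fin.ext_iff]; omega) (fun l ↦ by simp [Fin.ext_iff]; omega)
    (intMul_one _ _)
  rw [List.ofFn_add, List.reverse_append, List.prod_append, Module.End.mul_apply,
    Module.End.mul_apply]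
  have hneg : ∀ (x y : ℝ) (T : Module.End ℝ
      (ExteriorAlgebra ℝ (EuclideanSpace ℝ (Fin (2 * p + 2 * q))))),
      x • 1 + -y • T = x • 1 - y • T := fun x y T ↦ by
    rw [sub_eq_add_neg]
    exact congrArg _ (neg_smul y T)
  simp only [hneg] at hr hann
  refine (congrArg (DFunLike.coe _) ((congrArg (DFunLike.coe _)
    (LinearMap.congr_fun hrot _)).trans (hl _ hann))).trans ?_
  rw [map_smul]
  refine (congrArg _ hr).trans ?_
  rw [smul_smul, Finset.prod_neg, Finset.card_univ, Fintype.card_fin]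
  congr 1
  ring
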